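/- arXiv:1511.02801 — 3 statements merged into one kernel-verified Lean document; each statement's English description precedes it below -/
import Mathlib

section
/- Let G = (V, E) be a finite simple graph, S ⊆ V a set of terminals, L ∈ ℕ, and let a be L-limited length constraints on S. Then the minimum size of an a-bounded S-multicut of G equals the minimum, taken over all L-limited length constraints b on S that satisfy the triangle inequalities and satisfy a ⪯ b, of the minimum size of a b-bounded S-multicut of G. -/
open SimpleGraph

/-- `F` is an `a`-bounded `S`-multicut of `G`: `F` is a set of edges of `G` such that
after deleting `F`, the distance between any two distinct terminals `s, t ∈ S`
is at least `a s t` (distance being `⊤` when no path exists). -/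
def IsLBMulticut {V : Type*} (G : SimpleGraph V) (S : Set V) (a : V → V → ℕ)
    (F : Set (Sym2 V)) : Prop :=
  F ⊆ G.edgeSet ∧
    ∀ s ∈ S, ∀ t ∈ S, s ≠ t → (a s t : ℕ∞) ≤ (G.deleteEdges F).edist s t

/-- The minimum size of an `a`-bounded `S`-multicut of `G`. -/
noncomputable def minMulticutSize {V : Type*} (G : SimpleGraph V) (S : Set V)
    (a : V → V → ℕ) : ℕ :=
  sInf {n : ℕ | ∃ F : Set (Sym2 V), IsLBMulticut G S a F ∧ F.ncard = n}

/-- Deleting all edges is an `a`-bounded multicut, whatever the constraints. -/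
theorem isLBMulticut_edgeSet {V : Type*} (G : SimpleGraph V) (S : Set V) (a : V → V → ℕ) :
    IsLBMulticut G S a G.edgeSet := by
  refine ⟨subset_rfl, fun s _ t _ hst => ?_⟩
  have hbot : G.deleteEdges G.edgeSet = ⊥ := by
    ext u v
    simp
  rw [hbot, SimpleGraph.edist_bot_of_ne hst]
  exact le_top

theorem exists_isLBMulticut_ncard_eq {V : Type*} (G : SimpleGraph V) (S : Set V)
    (a : V → V → ℕ) : ∃ F, IsLBMulticut G S a F ∧ F.ncard = minMulticutSize G S a :=
  Nat.sInf_mem (s := {n : ℕ | ∃ F : Set (Sym2 V), IsLBMulticut G S a F ∧ F.ncard = n})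
    ⟨_, _, isLBMulticut_edgeSet G S a, rfl⟩

theorem IsLBMulticut.minMulticutSize_le {V : Type*} {G : SimpleGraph V} {S : Set V}
    {a : V → V → ℕ} {F : Set (Sym2 V)} (hF : IsLBMulticut G S a F) :
    minMulticutSize G S a ≤ F.ncard :=
  Nat.sInf_le ⟨F, hF, rfl⟩

theorem IsLBMulticut.anti {V : Type*} {G : SimpleGraph V} {S : Set V} {a b : V → V → ℕ}
    {F : Set (Sym2 V)} (hF : IsLBMulticut G S b F)
    (hab : ∀ s ∈ S, ∀ t ∈ S, s ≠ t → a s t ≤ b s t) : IsLBMulticut G S a F :=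
  ⟨hF.1, fun s hs t ht hst =>
    (Nat.cast_le.mpr (hab s hs t ht hst)).trans (hF.2 s hs t ht hst)⟩

theorem minMulticutSize_mono {V : Type*} {G : SimpleGraph V} {S : Set V} {a b : V → V → ℕ}
    (hab : ∀ s ∈ S, ∀ t ∈ S, s ≠ t → a s t ≤ b s t) :
    minMulticutSize G S a ≤ minMulticutSize G S b := by
  obtain ⟨F, hF, hcard⟩ := exists_isLBMulticut_ncard_eq G S b
  exact hcard ▸ (hF.anti hab).minMulticutSize_le

/-- The distance in `G`, truncated at `L`. -/
noncomputable def truncDist {V : Type*} (G : SimpleGraph V) (L : ℕ) (s t : V) : ℕ :=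
  (min (L : ℕ∞) (G.edist s t)).toNat

theorem coe_truncDist {V : Type*} (G : SimpleGraph V) (L : ℕ) (s t : V) :
    (truncDist G L s t : ℕ∞) = min (L : ℕ∞) (G.edist s t) :=
  ENat.natCast_toNat (ne_top_of_le_ne_top (ENat.natCast_ne_top L) (min_le_left _ _))

theorem truncDist_comm {V : Type*} (G : SimpleGraph V) (L : ℕ) (s t : V) :
    truncDist G L s t = truncDist G L t s := by
  rw [truncDist, truncDist, SimpleGraph.edist_comm]

theorem truncDist_le {V : Type*} (G : SimpleGraph V) (L : ℕ) (s t : V) :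
    truncDist G L s t ≤ L := by
  rw [← Nat.cast_le (α := ℕ∞), coe_truncDist]
  exact min_le_left _ _

theorem truncDist_triangle {V : Type*} (G : SimpleGraph V) (L : ℕ) (s u t : V) :
    truncDist G L s t ≤ truncDist G L s u + truncDist G L u t := by
  rw [← Nat.cast_le (α := ℕ∞), Nat.cast_add]
  simp only [coe_truncDist]
  rcases le_total (L : ℕ∞) (G.edist s u) with hsu | hsu
  · rw [min_eq_left hsu]
    exact (min_le_left _ _).trans le_self_add
  rcases le_total (L : ℕ∞) (G.edist u t) with hut | hut
  · rw [min_eq_left hut]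
    exact (min_le_left _ _).trans le_add_self
  rw [min_eq_right hsu, min_eq_right hut]
  exact (min_le_right _ _).trans G.edist_triangle

/-- For `L`-limited length constraints `a` on `S`, the minimum size of an `a`-bounded
`S`-multicut of `G` equals the minimum, over all `L`-limited length constraints `b` on `S`
satisfying the triangle inequalities with `a ⪯ b`, of the minimum size of a `b`-bounded
`S`-multicut of `G`. -/
theorem minMulticut_eq_min_over_triangle {V : Type*} [Fintype V]
    (G : SimpleGraph V) (S : Set V) (L : ℕ)
    (a : V → V → ℕ) (hsym : ∀ s t, a s t = a t s)
    (hlim : ∀ s ∈ S, ∀ t ∈ S, s ≠ t → a s t ≤ L) :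
    minMulticutSize G S a =
      sInf {n : ℕ | ∃ b : V → V → ℕ,
        (∀ s t, b s t = b t s) ∧
        (∀ s ∈ S, ∀ t ∈ S, s ≠ t → b s t ≤ L) ∧
        (∀ s ∈ S, ∀ t ∈ S, ∀ u ∈ S, s ≠ t → s ≠ u → t ≠ u → b s t ≤ b s u + b u t) ∧
        (∀ s ∈ S, ∀ t ∈ S, s ≠ t → a s t ≤ b s t) ∧
        n = minMulticutSize G S b} := by
  apply le_antisymm
  · refine le_csInf ⟨_, fun _ _ => L, fun _ _ => rfl, fun _ _ _ _ _ => le_rfl,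
      fun _ _ _ _ _ _ _ _ _ => Nat.le_add_right _ _, hlim, rfl⟩ ?_
    rintro n ⟨b, -, -, -, hab, rfl⟩
    exact minMulticutSize_mono hab
  · obtain ⟨F, hF, hcard⟩ := exists_isLBMulticut_ncard_eq G S a
    have hcut : IsLBMulticut G S (truncDist (G.deleteEdges F) L) F :=
      ⟨hF.1, fun s _ t _ _ => (coe_truncDist _ L s t).trans_le (min_le_right _ _)⟩
    refine le_trans (Nat.sInf_le ?_) (hcut.minMulticutSize_le.trans_eq hcard)
    refine ⟨truncDist (G.deleteEdges F) L, truncDist_comm _ L,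
      fun s _ t _ _ => truncDist_le _ L s t,
      fun s _ t _ u _ _ _ _ => truncDist_triangle _ L s u t, fun s hs t ht hst => ?_, rfl⟩
    rw [← Nat.cast_le (α := ℕ∞), coe_truncDist]
    exact le_min (Nat.cast_le.mpr (hlim s hs t ht hst)) (hF.2 s hs t ht hst)
end

section
/- Let h ≥ 0 and Q ≥ 1, let B = B(s, t, h, Q) be a butte, and let F ⊆ E(B) be any set of edges with |F| < Q. Then s and t are still connected in the graph B − F, and moreover the distance between s and t in B − F is at most h + 2. -/
/-- The vertices of the butte `B(s, t, h, Q)`: the two endpoints `s` and `t`, the midpoint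
`sc c` of the `c`-th shortcut (an `s`–`t` path of length `2`), and the `p`-th internal
vertex `rw q p` of the `q`-th ridgeway (an `s`–`t` path of length `h + 2`, having `h + 1`
internal vertices). -/
inductive ButteV (h Q : ℕ) : Type
  | s : ButteV h Q
  | t : ButteV h Q
  | sc : Fin h → ButteV h Q
  | rw : Fin Q → Fin (h + 1) → ButteV h Q

/-- Generating relation for the edges of the butte. -/
def butteRel (h Q : ℕ) : ButteV h Q → ButteV h Q → Prop
  | .s, .sc _ => True
  | .sc _, .t => True
  | .s, .rw _ p => p.val = 0
  | .rw _ p, .t => p.val = h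
  | .rw q p, .rw q' p' => q = q' ∧ p'.val = p.val + 1
  | _, _ => False

/-- The butte `B(s, t, h, Q)`: `h` internally disjoint `s`–`t` paths of length `2`
(shortcuts) and `Q` internally disjoint `s`–`t` paths of length `h + 2` (ridgeways). -/
def butte (h Q : ℕ) : SimpleGraph (ButteV h Q) :=
  SimpleGraph.fromRel (butteRel h Q)

instance (h Q : ℕ) : Finite (ButteV h Q) := by
  let code : ButteV h Q → Bool ⊕ Fin h ⊕ Fin Q × Fin (h + 1) := fun
    | .s => .inl true
    | .t => .inl false
    | .sc c => .inr (.inl c)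
    | .rw q p => .inr (.inr (q, p))
  refine Finite.of_injective code fun x y hxy => ?_
  cases x <;> cases y <;> simp_all [code]

/-- An edge of the butte meets the interior of at most one ridgeway. -/
theorem butte_ridgeway_eq_of_mem_edge {h Q : ℕ} {e : Sym2 (ButteV h Q)}
    (he : e ∈ (butte h Q).edgeSet) {q q' : Fin Q} {p p' : Fin (h + 1)}
    (hq : ButteV.rw q p ∈ e) (hq' : ButteV.rw q' p' ∈ e) : q = q' := by
  induction e using Sym2.ind with
  | _ x y =>
    rw [SimpleGraph.mem_edgeSet, butte, SimpleGraph.fromRel_adj] at he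
    rw [Sym2.mem_iff] at hq hq'
    rcases hq with rfl | rfl <;> rcases hq' with hq' | hq' <;> first
      | exact (ButteV.rw.inj hq').1.symm
      | subst hq'
        rcases he.2 with hrel | hrel
        · first | exact hrel.1 | exact hrel.1.symm
        · first | exact hrel.1 | exact hrel.1.symm

/-- Fewer than `Q` edges of the butte leave the interior of some ridgeway untouched. -/
theorem exists_ridgeway_avoiding {h Q : ℕ} {F : Set (Sym2 (ButteV h Q))}
    (hFsub : F ⊆ (butte h Q).edgeSet) (hFcard : F.ncard < Q) :
    ∃ q : Fin Q, ∀ e ∈ F, ∀ p, ButteV.rw q p ∉ e := by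
  by_contra! hall
  choose f hfF p hp using hall
  have hinj : Function.Injective f := fun q q' hqq' =>
    butte_ridgeway_eq_of_mem_edge (hFsub (hfF q)) (hp q) (hqq' ▸ hp q')
  have hle : (Set.range f).ncard ≤ F.ncard :=
    Set.ncard_le_ncard (Set.range_subset_iff.2 hfF) F.toFinite
  rw [← Set.image_univ, Set.ncard_image_of_injective _ hinj, Set.ncard_univ, Nat.card_fin] at hle
  omega

/-- Along a ridgeway untouched by `F`, the `k`-th internal vertex is joined to `s` by a walk of
length `k + 1` in the butte without `F`. -/
theorem exists_walk_ridgeway {h Q : ℕ} {F : Set (Sym2 (ButteV h Q))} {q : Fin Q}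
    (hq : ∀ e ∈ F, ∀ p, ButteV.rw q p ∉ e) (k : ℕ) (hk : k < h + 1) :
    ∃ w : ((butte h Q).deleteEdges F).Walk ButteV.s (ButteV.rw q ⟨k, hk⟩), w.length = k + 1 := by
  induction k with
  | zero =>
    have hadj : ((butte h Q).deleteEdges F).Adj ButteV.s (ButteV.rw q ⟨0, hk⟩) := by
      rw [SimpleGraph.deleteEdges_adj]
      exact ⟨by simp [butte, butteRel], fun he => hq _ he _ (Sym2.mem_mk_right _ _)⟩
    exact ⟨hadj.toWalk, rfl⟩
  | succ k ih =>
    obtain ⟨w, hw⟩ := ih (by omega)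
    have hadj : ((butte h Q).deleteEdges F).Adj (ButteV.rw q ⟨k, by omega⟩)
        (ButteV.rw q ⟨k + 1, hk⟩) := by
      rw [SimpleGraph.deleteEdges_adj]
      exact ⟨by simp [butte, butteRel], fun he => hq _ he _ (Sym2.mem_mk_right _ _)⟩
    exact ⟨w.concat hadj, by rw [SimpleGraph.Walk.length_concat, hw]⟩

/-- For `h ≥ 0`, `Q ≥ 1` and any set `F` of edges of the butte `B = B(s, t, h, Q)` with
`|F| < Q`, the vertices `s` and `t` are still connected in `B − F`, and the distance
between `s` and `t` in `B − F` is at most `h + 2`. -/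
theorem butte_not_cut_of_card_lt (h Q : ℕ) (hQ : 1 ≤ Q)
    (F : Set (Sym2 (ButteV h Q)))
    (hFsub : F ⊆ (butte h Q).edgeSet) (hFcard : F.ncard < Q) :
    ((butte h Q).deleteEdges F).Reachable ButteV.s ButteV.t ∧
      ((butte h Q).deleteEdges F).edist ButteV.s ButteV.t ≤ (h : ℕ∞) + 2 := by
  obtain ⟨q, hq⟩ := exists_ridgeway_avoiding hFsub hFcard
  obtain ⟨w, hw⟩ := exists_walk_ridgeway hq h (Nat.lt_succ_self h)
  have hadj : ((butte h Q).deleteEdges F).Adj (ButteV.rw q ⟨h, Nat.lt_succ_self h⟩)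
      ButteV.t := by
    rw [SimpleGraph.deleteEdges_adj]
    exact ⟨by simp [butte, butteRel], fun he => hq _ he _ (Sym2.mem_mk_left _ _)⟩
  refine ⟨(w.concat hadj).reachable, (SimpleGraph.Walk.edist_le (w.concat hadj)).trans ?_⟩
  rw [SimpleGraph.Walk.length_concat, hw]
  norm_cast
end

section
/- Let k ≥ 2 and N, M ≥ 2, let G be a k-partite graph with parts V_1, …, V_k, each an independent set of size N, such that each edge set E_{ij} between V_i and V_j (i < j) has size M, and let (G', s, t, L) be the MLBC instance constructed from G by the reduction. If G contains a multicolor k-clique, i.e. vertices v_1 ∈ V_1, …, v_k ∈ V_k that are pairwise adjacent in G, then G' has an L-bounded cut between s and t of size k(k − 1)(N⁴ + N² + N). -/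
/-- Vertices of the graph `G'` of the MLBC reduction for parameters `k, N, M` and butte
heights `hgt i j b` (the height of the `b`-th butte of the highland `H^{i,j}`).
`s` and `t` are the global source and sink shared by all highlands; `junc i j m` is the
`(m+1)`-st internal junction of the highland `H^{i,j}` (its junctions are indexed
`0, …, N + M`, with junction `0 = s` and junction `N + M = t`); `sc i j b c` is the
midpoint of the `c`-th shortcut of the `b`-th butte of `H^{i,j}`; `rw i j b q p` is the
`p`-th internal vertex of the `q`-th ridgeway of that butte (each butte has
`Q = N⁴ + N²` ridgeways); `valley i j ℓ v` (used for `i < j`) is the `v`-th internal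
vertex of the valley path of length `N − 1` joining `t(B^{i,j}_{N+ℓ+1})` and
`t(B^{j,i}_{N+ℓ+1})`. -/
inductive RV (k N M : ℕ) (hgt : Fin k → Fin k → Fin (N + M) → ℕ) : Type
  | s : RV k N M hgt
  | t : RV k N M hgt
  | junc : Fin k → Fin k → Fin (N + M - 1) → RV k N M hgt
  | sc : (i j : Fin k) → (b : Fin (N + M)) → Fin (hgt i j b) → RV k N M hgt
  | rw : (i j : Fin k) → (b : Fin (N + M)) → Fin (N ^ 4 + N ^ 2) →
      Fin (hgt i j b + 1) → RV k N M hgt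
  | valley : Fin k → Fin k → Fin (M - 1) → Fin (N - 2) → RV k N M hgt

/-- The `m`-th junction vertex of the highland `H^{i,j}` in `G'`: junction `0` is `s`,
junction `N + M` is `t`, and the junctions in between are the `junc` vertices. -/
def J {k N M : ℕ} {hgt : Fin k → Fin k → Fin (N + M) → ℕ} (i j : Fin k) (m : ℕ) :
    RV k N M hgt :=
  if h0 : m = 0 then RV.s
  else if h1 : m ≤ N + M - 1 then RV.junc i j ⟨m - 1, by omega⟩ else RV.t

/-- Generating relation for the edges of the reduction graph `G'`: for every ordered pair
`(i, j)` with `i ≠ j`, the highland `H^{i,j}(N, M, s, t)` (shortcut edges, ridgeway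
edges); the edges `{t(B^{i,j}_ℓ), t(B^{i,j+1}_ℓ)}` for `1 ≤ ℓ < N` connecting consecutive
highlands of part `i` at low buttes (`j, j+1 ≠ i`); and the valley paths of length
`N − 1` connecting `t(B^{i,j}_{N+ℓ})` and `t(B^{j,i}_{N+ℓ})` for `1 ≤ ℓ < M`. -/
def redRel (k N M : ℕ) (hgt : Fin k → Fin k → Fin (N + M) → ℕ) :
    RV k N M hgt → RV k N M hgt → Prop := fun x y =>
  -- shortcut edges of the buttes
  (∃ (i j : Fin k) (b : Fin (N + M)) (c : Fin (hgt i j b)),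
      i ≠ j ∧ x = J i j b.val ∧ y = RV.sc i j b c) ∨
  (∃ (i j : Fin k) (b : Fin (N + M)) (c : Fin (hgt i j b)),
      i ≠ j ∧ x = RV.sc i j b c ∧ y = J i j (b.val + 1)) ∨
  -- ridgeway edges of the buttes
  (∃ (i j : Fin k) (b : Fin (N + M)) (q : Fin (N ^ 4 + N ^ 2)) (p : Fin (hgt i j b + 1)),
      i ≠ j ∧ p.val = 0 ∧ x = J i j b.val ∧ y = RV.rw i j b q p) ∨
  (∃ (i j : Fin k) (b : Fin (N + M)) (q : Fin (N ^ 4 + N ^ 2))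
      (p p' : Fin (hgt i j b + 1)),
      i ≠ j ∧ p'.val = p.val + 1 ∧ x = RV.rw i j b q p ∧ y = RV.rw i j b q p') ∨
  (∃ (i j : Fin k) (b : Fin (N + M)) (q : Fin (N ^ 4 + N ^ 2)) (p : Fin (hgt i j b + 1)),
      i ≠ j ∧ p.val = hgt i j b ∧ x = RV.rw i j b q p ∧ y = J i j (b.val + 1)) ∨
  -- edges connecting consecutive highlands of the same part at low buttes
  (∃ (i j j' : Fin k) (ℓ : Fin (N - 1)),
      j'.val = j.val + 1 ∧ i ≠ j ∧ i ≠ j' ∧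
      x = J i j (ℓ.val + 1) ∧ y = J i j' (ℓ.val + 1)) ∨
  -- valley paths of length N − 1 between paired high buttes
  (∃ (i j : Fin k) (ℓ : Fin (M - 1)), i < j ∧
      ((N = 2 ∧ x = J i j (N + ℓ.val + 1) ∧ y = J j i (N + ℓ.val + 1)) ∨
       (∃ v : Fin (N - 2), v.val = 0 ∧
          x = J i j (N + ℓ.val + 1) ∧ y = RV.valley i j ℓ v) ∨
       (∃ v v' : Fin (N - 2), v'.val = v.val + 1 ∧
          x = RV.valley i j ℓ v ∧ y = RV.valley i j ℓ v') ∨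
       (∃ v : Fin (N - 2), v.val + 1 = N - 2 ∧
          x = RV.valley i j ℓ v ∧ y = J j i (N + ℓ.val + 1))))

/-- The reduction graph `G'`. -/
def redGraph (k N M : ℕ) (hgt : Fin k → Fin k → Fin (N + M) → ℕ) :
    SimpleGraph (RV k N M hgt) :=
  SimpleGraph.fromRel (redRel k N M hgt)

/-- Heights of the buttes of the highland `H^{i,j}` in the reduction, given the
enumeration `E` of the edges between the parts: the `ℓ`-th low butte (`1 ≤ ℓ ≤ N`,
representing the `ℓ`-th vertex of `V_i`) has height `N² + ℓ`, and the high butte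
representing the edge `e_ℓ ∈ E_{ij}` has height `N⁴ + N − p`, where `p` is the 1-based
index in the enumeration of `V_i` of the endpoint of `e_ℓ` lying in `V_i`. -/
def redHeights (k N M : ℕ) (E : Fin k → Fin k → Fin M → Fin N × Fin N) :
    Fin k → Fin k → Fin (N + M) → ℕ := fun i j b =>
  if h : b.val < N then N ^ 2 + b.val + 1
  else N ^ 4 + N - 1 -
    (if i < j then (E i j ⟨b.val - N, by omega⟩).1
     else (E j i ⟨b.val - N, by omega⟩).2).val

section Cut

variable {k N M : ℕ} {hgt : Fin k → Fin k → Fin (N + M) → ℕ}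

theorem J_ne_sc (i j : Fin k) (m : ℕ) (i' j' : Fin k) (b : Fin (N + M))
    (c : Fin (hgt i' j' b)) : (J i j m : RV k N M hgt) ≠ RV.sc i' j' b c := by
  unfold J
  split_ifs <;> simp

/-- The edge from the start of the butte `b` of `H^{i,j}` to the midpoint of its shortcut `c`. -/
def shortcutEdge (i j : Fin k) (b : Fin (N + M)) (c : Fin (hgt i j b)) :
    Sym2 (RV k N M hgt) :=
  s(J i j b.val, RV.sc i j b c)

theorem shortcutEdge_eq_iff {i j i' j' : Fin k} {b b' : Fin (N + M)} {c : Fin (hgt i j b)}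
    {c' : Fin (hgt i' j' b')} :
    (shortcutEdge i j b c : Sym2 (RV k N M hgt)) = shortcutEdge i' j' b' c' ↔
      (RV.sc i j b c : RV k N M hgt) = RV.sc i' j' b' c' := by
  constructor
  · intro h
    rcases Sym2.eq_iff.mp h with h | h
    · exact h.2
    · exact absurd h.1 (J_ne_sc _ _ _ _ _ _ _)
  · intro h
    cases h
    rfl

theorem shortcutEdge_mem_edgeSet {i j : Fin k} (hij : i ≠ j) (b : Fin (N + M))
    (c : Fin (hgt i j b)) : shortcutEdge i j b c ∈ (redGraph k N M hgt).edgeSet := by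
  rw [shortcutEdge, SimpleGraph.mem_edgeSet, redGraph, SimpleGraph.fromRel_adj]
  exact ⟨J_ne_sc _ _ _ _ _ _ _, Or.inl (Or.inl ⟨i, j, b, c, hij, rfl, rfl⟩)⟩

/-- One edge of every shortcut of the buttes `lo i j` and `hi i j`, for all `i ≠ j`. -/
def butteCut (lo hi : Fin k → Fin k → Fin (N + M)) : Set (Sym2 (RV k N M hgt)) :=
  {e | ∃ (i j : Fin k) (b : Fin (N + M)) (c : Fin (hgt i j b)),
    i ≠ j ∧ (b = lo i j ∨ b = hi i j) ∧ e = shortcutEdge i j b c}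

theorem butteCut_subset_edgeSet (lo hi : Fin k → Fin k → Fin (N + M)) :
    butteCut lo hi ⊆ (redGraph k N M hgt).edgeSet := by
  rintro _ ⟨i, j, b, c, hij, -, rfl⟩
  exact shortcutEdge_mem_edgeSet hij b c

theorem ncard_butteCut {lo hi : Fin k → Fin k → Fin (N + M)} {n : ℕ}
    (hne : ∀ i j, i ≠ j → lo i j ≠ hi i j)
    (hsum : ∀ i j, i ≠ j → hgt i j (lo i j) + hgt i j (hi i j) = n) :
    (butteCut lo hi : Set (Sym2 (RV k N M hgt))).ncard = k * (k - 1) * n := by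
  let T := Σ p : {p : Fin k × Fin k // p.1 ≠ p.2},
    Fin (hgt p.1.1 p.1.2 (lo p.1.1 p.1.2)) ⊕ Fin (hgt p.1.1 p.1.2 (hi p.1.1 p.1.2))
  let f : T → Sym2 (RV k N M hgt) := fun x =>
    x.2.elim (shortcutEdge x.1.1.1 x.1.1.2 _) (shortcutEdge x.1.1.1 x.1.1.2 _)
  have hf : Function.Injective f := by
    rintro ⟨⟨⟨i, j⟩, hij⟩, c | c⟩ ⟨⟨⟨i', j'⟩, hij'⟩, c' | c'⟩ h <;>
      have h := shortcutEdge_eq_iff.mp h <;>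
      simp only [RV.sc.injEq] at h <;>
      obtain ⟨rfl, rfl, hb, hc⟩ := h
    · rw [eq_of_heq hc]
    · exact absurd hb (hne _ _ hij)
    · exact absurd hb.symm (hne _ _ hij)
    · rw [eq_of_heq hc]
  have hrange : (butteCut lo hi : Set (Sym2 (RV k N M hgt))) = Set.range f := by
    ext e
    constructor
    · rintro ⟨i, j, b, c, hij, rfl | rfl, rfl⟩
      · exact ⟨⟨⟨(i, j), hij⟩, Sum.inl c⟩, rfl⟩
      · exact ⟨⟨⟨(i, j), hij⟩, Sum.inr c⟩, rfl⟩
    · rintro ⟨⟨⟨⟨i, j⟩, hij⟩, c | c⟩, rfl⟩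
      · exact ⟨i, j, _, c, hij, Or.inl rfl, rfl⟩
      · exact ⟨i, j, _, c, hij, Or.inr rfl, rfl⟩
  have hpairs : Fintype.card {p : Fin k × Fin k // p.1 ≠ p.2} = k * (k - 1) := by
    rw [Fintype.card_subtype]
    have h := Finset.offDiag_card (Finset.univ : Finset (Fin k))
    rw [Finset.card_fin] at h
    rw [Nat.mul_sub_one, ← h]
    congr 1
    ext p
    simp
  rw [hrange, Set.ncard_def, ← Set.image_univ, hf.injOn.encard_image, ← Set.ncard_def,
    Set.ncard_univ, Nat.card_eq_fintype_card, Fintype.card_sigma,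
    Finset.sum_congr rfl (g := fun _ => n), Finset.sum_const, Finset.card_univ, hpairs,
    smul_eq_mul]
  rintro ⟨⟨i, j⟩, hij⟩ -
  rw [Fintype.card_sum, Fintype.card_fin, Fintype.card_fin]
  exact hsum i j hij

end Cut

section Potential

variable {k N M : ℕ} {hgt : Fin k → Fin k → Fin (N + M) → ℕ}

/-- The potential of a vertex of `G'` when the `m`-th junction of `H^{i,j}` has potential
`lev i j m` and the sink has potential `top`. -/
def potential (lev : Fin k → Fin k → ℕ → ℕ) (top : ℕ) : RV k N M hgt → ℕ
  | .s => 0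
  | .t => top
  | .junc i j m => lev i j (m.val + 1)
  | .sc i j b _ => lev i j (b.val + 1) - 1
  | .rw i j b _ p => min (lev i j b.val + p.val + 1) (lev i j (b.val + 1))
  | .valley i j ℓ u => min (lev i j (N + ℓ.val + 1) + u.val + 1)
      (lev j i (N + ℓ.val + 1) + (N - 2 - u.val))

theorem potential_J {lev : Fin k → Fin k → ℕ → ℕ} {top : ℕ} {i j : Fin k}
    (h0 : lev i j 0 = 0) (htop : lev i j (N + M) = top) {m : ℕ} (hm : m ≤ N + M) :
    potential lev top (J i j m : RV k N M hgt) = lev i j m := by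
  unfold J
  split_ifs with hm0 hm1
  · rw [hm0, h0, potential]
  · rw [potential, Nat.sub_add_cancel (by omega)]
  · rw [potential, show m = N + M by omega, htop]

/-- Along every edge of `G'` that is not in the cut, the potential changes by at most one. -/
theorem potential_lipschitz {lev : Fin k → Fin k → ℕ → ℕ} {top : ℕ}
    {lo hi : Fin k → Fin k → Fin (N + M)}
    (h0 : ∀ i j, i ≠ j → lev i j 0 = 0) (htop : ∀ i j, i ≠ j → lev i j (N + M) = top)
    (hstep : ∀ i j, i ≠ j → ∀ b : Fin (N + M), lev i j (b.val + 1) = lev i j b.val + 2 ∨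
      (b = lo i j ∨ b = hi i j) ∧ lev i j (b.val + 1) = lev i j b.val + hgt i j b + 2)
    (hlow : ∀ i j j', i ≠ j → i ≠ j' → ∀ m < N, lev i j m = lev i j' m)
    (hvalley : ∀ i j, i ≠ j → ∀ m, N < m → lev i j m ≤ lev j i m + (N - 1))
    {x y : RV k N M hgt} (hxy : redRel k N M hgt x y) (hC : s(x, y) ∉ butteCut lo hi) :
    potential lev top x ≤ potential lev top y + 1 ∧
      potential lev top y ≤ potential lev top x + 1 := by
  have hJ : ∀ i j, i ≠ j → ∀ m ≤ N + M,
      potential lev top (J i j m : RV k N M hgt) = lev i j m :=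
    fun i j hij m hm => potential_J (h0 i j hij) (htop i j hij) hm
  rcases hxy with ⟨i, j, b, c, hij, rfl, rfl⟩ | ⟨i, j, b, c, hij, rfl, rfl⟩ |
    ⟨i, j, b, q, p, hij, hp, rfl, rfl⟩ | ⟨i, j, b, q, p, p', hij, hp, rfl, rfl⟩ |
    ⟨i, j, b, q, p, hij, hp, rfl, rfl⟩ | ⟨i, j, j', ℓ, -, hij, hij', rfl, rfl⟩ |
    ⟨i, j, ℓ, hij, h⟩
  · rw [hJ i j hij _ b.isLt.le, potential]
    rcases hstep i j hij b with h | ⟨h, -⟩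
    · omega
    · exact absurd ⟨i, j, b, c, hij, h, rfl⟩ hC
  · rw [hJ i j hij (b.val + 1) b.isLt, potential]
    rcases hstep i j hij b with h | ⟨-, h⟩ <;> omega
  · rw [hJ i j hij _ b.isLt.le, potential]
    rcases hstep i j hij b with h | ⟨-, h⟩ <;> omega
  · rw [potential, potential]
    omega
  · rw [hJ i j hij (b.val + 1) b.isLt, potential]
    rcases hstep i j hij b with h | ⟨-, h⟩ <;> omega
  · rw [hJ i j hij _ (by omega), hJ i j' hij' _ (by omega),
      hlow i j j' hij hij' _ (by omega)]
    omega
  · have hij' := hij.ne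
    have hle := hvalley i j hij' (N + ℓ.val + 1) (by omega)
    have hge := hvalley j i hij'.symm (N + ℓ.val + 1) (by omega)
    rcases h with ⟨hN, rfl, rfl⟩ | ⟨u, hu, rfl, rfl⟩ | ⟨u, u', hu, rfl, rfl⟩ |
      ⟨u, hu, rfl, rfl⟩
    · rw [hJ i j hij' _ (by omega), hJ j i hij'.symm _ (by omega)]
      omega
    · rw [hJ i j hij' _ (by omega), potential]
      omega
    · rw [potential, potential]
      omega
    · rw [hJ j i hij'.symm _ (by omega), potential]
      omega

end Potential

theorem SimpleGraph.le_edist_of_potential {V : Type*} {G : SimpleGraph V} (f : V → ℕ)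
    (hf : ∀ x y, G.Adj x y → f y ≤ f x + 1) {a b : V} (ha : f a = 0) :
    (f b : ℕ∞) ≤ G.edist a b := by
  have hwalk : ∀ {x y : V} (w : G.Walk x y), f y ≤ f x + w.length := by
    intro x y w
    induction w with
    | nil => simp
    | cons h w ih =>
      have := hf _ _ h
      rw [SimpleGraph.Walk.length_cons]
      omega
  refine le_iInf fun w => ?_
  have := hwalk w
  rw [ha, zero_add] at this
  exact_mod_cast this

/-- Distance from `s` to the `m`-th junction of a highland whose low butte `a` and high butte
`N + e` have lost their shortcuts, where these buttes represent a vertex of index `a` and an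
edge incident to it. -/
def junctionLevel (N a e m : ℕ) : ℕ :=
  2 * m + (if a < m then N ^ 2 + a + 1 else 0) + (if N + e < m then N ^ 4 + N - 1 - a else 0)

/-- Soundness of the reduction: let `G` be a `k`-partite graph with parts
`V_1, …, V_k = Fin k × Fin N` (each an independent set of size `N`), whose edges between
any two parts `i < j` are enumerated without repetition by `E i j : Fin M → Fin N × Fin N`
(so each `E_{ij}` has size `M`), and let `(G', s, t, L)` be the MLBC instance produced by
the reduction, `L = 2(N + M) + N⁴ + N² + N − 1`. If `G` contains a multicolor `k`-clique
`v_1 ∈ V_1, …, v_k ∈ V_k`, then `G'` has an `L`-bounded cut between `s` and `t` of size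
`k(k − 1)(N⁴ + N² + N)`. -/
theorem reduction_sound (k N M : ℕ) (hk : 2 ≤ k) (hN : 2 ≤ N) (hM : 2 ≤ M)
    (G : SimpleGraph (Fin k × Fin N))
    (hpart : ∀ (i : Fin k) (a b : Fin N), ¬ G.Adj (i, a) (i, b))
    (E : Fin k → Fin k → Fin M → Fin N × Fin N)
    (hE : ∀ i j : Fin k, i < j → ∀ ℓ : Fin M, G.Adj (i, (E i j ℓ).1) (j, (E i j ℓ).2))
    (hEinj : ∀ i j : Fin k, i < j → Function.Injective (E i j))
    (hEsurj : ∀ i j : Fin k, i < j → ∀ a b : Fin N,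
      G.Adj (i, a) (j, b) → ∃ ℓ : Fin M, E i j ℓ = (a, b))
    (L : ℕ) (hL : L = 2 * (N + M) + N ^ 4 + N ^ 2 + N - 1)
    (v : Fin k → Fin N)
    (hclique : ∀ i j : Fin k, i ≠ j → G.Adj (i, v i) (j, v j)) :
    ∃ C : Set (Sym2 (RV k N M (redHeights k N M E))),
      C ⊆ (redGraph k N M (redHeights k N M E)).edgeSet ∧
      C.ncard = k * (k - 1) * (N ^ 4 + N ^ 2 + N) ∧
      (L + 1 : ℕ∞) ≤
        ((redGraph k N M (redHeights k N M E)).deleteEdges C).edist RV.s RV.t := by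
  have hedge : ∀ i j : Fin k, ∃ ℓ : Fin M, i < j → E i j ℓ = (v i, v j) := by
    intro i j
    by_cases hij : i < j
    · obtain ⟨ℓ, hℓ⟩ := hEsurj i j hij _ _ (hclique i j hij.ne)
      exact ⟨ℓ, fun _ => hℓ⟩
    · exact ⟨⟨0, by omega⟩, fun h => absurd h hij⟩
  choose e₀ he₀ using hedge
  let e : Fin k → Fin k → Fin M := fun i j => if i < j then e₀ i j else e₀ j i
  have he_symm : ∀ i j, i ≠ j → e i j = e j i := by
    intro i j hij
    rcases lt_or_gt_of_ne hij with h | h <;> simp [e, h, h.not_gt]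
  let lo : Fin k → Fin k → Fin (N + M) := fun i _ => Fin.castAdd M (v i)
  let hi : Fin k → Fin k → Fin (N + M) := fun i j => Fin.natAdd N (e i j)
  have hlo : ∀ i j, redHeights k N M E i j (lo i j) = N ^ 2 + (v i).val + 1 := by
    intro i j
    simp [redHeights, lo]
  have hhi : ∀ i j, i ≠ j →
      redHeights k N M E i j (hi i j) = N ^ 4 + N - 1 - (v i).val := by
    intro i j hij
    rcases lt_or_gt_of_ne hij with h | h <;>
      simp [redHeights, hi, e, h, h.not_gt, he₀ _ _ h]
  refine ⟨butteCut lo hi, butteCut_subset_edgeSet lo hi, ncard_butteCut ?_ ?_, ?_⟩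
  · intro i j _ h
    have := congrArg Fin.val h
    simp only [lo, hi, Fin.val_castAdd, Fin.val_natAdd] at this
    omega
  · intro i j hij
    rw [hlo, hhi i j hij]
    omega
  let lev : Fin k → Fin k → ℕ → ℕ := fun i j => junctionLevel N (v i) (e i j)
  have hlip := @potential_lipschitz k N M (redHeights k N M E) lev (L + 1) lo hi
    (by
      intro i j _
      simp [lev, junctionLevel])
    (by
      intro i j _
      simp only [lev, junctionLevel]
      rw [if_pos (by omega), if_pos (by omega)]
      omega)
    (by
      intro i j hij b
      have hlo_iff : b = lo i j ↔ b.val = (v i).val := by simp [lo, Fin.ext_iff]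
      have hhi_iff : b = hi i j ↔ b.val = N + (e i j).val := by simp [hi, Fin.ext_iff]
      have hblo : b = lo i j → redHeights k N M E i j b = N ^ 2 + (v i).val + 1 := by
        rintro rfl
        exact hlo i j
      have hbhi : b = hi i j → redHeights k N M E i j b = N ^ 4 + N - 1 - (v i).val := by
        rintro rfl
        exact hhi i j hij
      rw [hlo_iff] at hblo ⊢
      rw [hhi_iff] at hbhi ⊢
      simp only [lev, junctionLevel]
      split_ifs <;> omega)
    (by
      intro i j j' _ _ m hm
      simp only [lev, junctionLevel]
      rw [if_neg (by omega : ¬ N + (e i j).val < m),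
        if_neg (by omega : ¬ N + (e i j').val < m)])
    (by
      intro i j hij m hm
      simp only [lev, junctionLevel]
      rw [he_symm j i hij.symm]
      split_ifs <;> omega)
  refine SimpleGraph.le_edist_of_potential (potential lev (L + 1)) ?_ rfl
  intro x y hxy
  rw [SimpleGraph.deleteEdges_adj, redGraph, SimpleGraph.fromRel_adj] at hxy
  obtain ⟨⟨-, h | h⟩, hC⟩ := hxy
  · exact (hlip h hC).2
  · rw [Sym2.eq_swap] at hC
    exact (hlip h hC).1
end
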